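/- Let S be a closed connected orientable surface of genus g0 ≥ 2, and let G_S(g) denote the set of connected finite covers of S of genus at most g. Then there is a constant c1 > 0, depending only on S, such that for all sufficiently large g one has #G_S(g) ≥ (c1·g)^{2g}. -/

import Mathlib

/-!
STATEMENT 17 (Müller–Puchta lower bound on covers):
Let S be a closed connected orientable surface of genus g0 ≥ 2 and let
G_S(g) be the set of connected finite covers of S of genus at most g.  Then
there is c1 > 0, depending only on S, with #G_S(g) ≥ (c1·g)^{2g} for all
sufficiently large g.

Per the provided context, connected finite covers of S of degree n correspond
to index-n subgroups of π₁(S), and a degree-n cover has genus n(g0−1)+1.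
Accordingly, G_S(g) is formalized as the set of finite-index subgroups H of
the genus-g0 surface group with (index H)·(g0−1)+1 ≤ g.  The surface group is
defined concretely as a presented group.
-/

open Filter Topology

/-- The surface relator `[a₁,b₁]⋯[a_g,b_g]` in the free group on `2g`
generators. -/
def surfaceRelator (g : ℕ) : FreeGroup (Fin (2 * g)) :=
  ((List.finRange g).map (fun j =>
    FreeGroup.of (⟨2 * j.1, by have := j.2; omega⟩ : Fin (2 * g)) *
    FreeGroup.of (⟨2 * j.1 + 1, by have := j.2; omega⟩ : Fin (2 * g)) *
    (FreeGroup.of (⟨2 * j.1, by have := j.2; omega⟩ : Fin (2 * g)))⁻¹ *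
    (FreeGroup.of (⟨2 * j.1 + 1, by have := j.2; omega⟩ : Fin (2 * g)))⁻¹)).prod

/-- The fundamental group of the closed connected orientable surface of genus
`g`, as a presented group. -/
abbrev SurfaceGroup (g : ℕ) : Type := PresentedGroup {surfaceRelator g}

open MonoidAlgebra in
/-- The sum of all conjugates of `s` in the group algebra. -/
noncomputable def cls {G : Type} [Group G] [Fintype G] (s : G) : MonoidAlgebra ℕ G :=
  ∑ t : G, MonoidAlgebra.single (t * s * t⁻¹) 1

lemma cls_comm {G : Type} [Group G] [Fintype G] (s r : G) :
    Commute (cls s) (cls r) := by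
  unfold Commute SemiconjBy cls
  rw [Finset.sum_mul_sum, Finset.sum_mul_sum]
  rw [Finset.sum_comm]
  simp only [MonoidAlgebra.single_mul_single, mul_one]
  -- left: sum over y, x of (x s x⁻¹)(y r y⁻¹)
  refine Finset.sum_congr rfl fun y _ => ?_
  refine Fintype.sum_equiv (Equiv.mulLeft (y * r * y⁻¹)⁻¹) _ _ fun x => ?_
  congr 1
  simp only [Equiv.coe_mulLeft]
  group

lemma cls_coeff {G : Type} [Group G] [Fintype G] (s : G) (k : ℕ) (w : G) :
    ((cls s) ^ k).coeff w = ((cls s⁻¹) ^ k).coeff w⁻¹ := by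
  classical
  induction k generalizing w with
  | zero =>
    simp only [pow_zero, MonoidAlgebra.one_def, MonoidAlgebra.coeff_single_apply]
    simp [eq_comm]
  | succ k ih =>
    rw [pow_succ, pow_succ']
    have e1 : cls s ^ k * cls s = cls s ^ k * ∑ t : G, MonoidAlgebra.single (t * s * t⁻¹) 1 := rfl
    have e2 : cls s⁻¹ * cls s⁻¹ ^ k =
        (∑ t : G, MonoidAlgebra.single (t * s⁻¹ * t⁻¹) 1) * cls s⁻¹ ^ k := rfl
    rw [e1, e2]
    rw [Finset.mul_sum, Finset.sum_mul]
    simp only [MonoidAlgebra.coeff_sum, Finsupp.finsetSum_apply,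
      MonoidAlgebra.coeff_mul_single_apply, MonoidAlgebra.coeff_single_mul_apply, mul_one, one_mul]
    refine Finset.sum_congr rfl fun t _ => ?_
    rw [ih]
    congr 2
    group

lemma cls_mass {G : Type} [Group G] [Fintype G] (s : G) (k : ℕ) :
    ∑ w : G, ((cls s) ^ k).coeff w = (Fintype.card G) ^ k := by
  classical
  induction k with
  | zero =>
    simp [MonoidAlgebra.one_def, MonoidAlgebra.coeff_single_apply]
  | succ k ih =>
    rw [pow_succ]
    have e1 : cls s ^ k * cls s = cls s ^ k * ∑ t : G, MonoidAlgebra.single (t * s * t⁻¹) 1 := rfl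
    rw [e1]
    rw [Finset.mul_sum]
    simp only [MonoidAlgebra.coeff_sum, Finsupp.finsetSum_apply,
      MonoidAlgebra.coeff_mul_single_apply, mul_one]
    rw [Finset.sum_comm, pow_succ, ← ih, mul_comm]
    have e2 : ∀ t : G, ∑ x : G, ((cls s) ^ k).coeff (x * (t * s * t⁻¹)⁻¹) =
        ∑ w : G, ((cls s) ^ k).coeff w := fun t =>
      Equiv.sum_comp (Equiv.mulRight (t * s * t⁻¹)⁻¹) (fun w => ((cls s) ^ k).coeff w)
    rw [Finset.sum_congr rfl (fun t _ => e2 t)]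
    simp

/-- The word map. -/
def wd {G : Type} [Group G] (s : G) (k : ℕ) (p : Fin k → G × G) : G :=
  ((List.finRange k).map (fun i =>
    ((p i).1 * s * (p i).1⁻¹) * ((p i).2 * s⁻¹ * (p i).2⁻¹))).prod

lemma cls_expand {G : Type} [Group G] [Fintype G] (s : G) (k : ℕ) :
    (cls s * cls s⁻¹) ^ k =
      ∑ p : Fin k → G × G, MonoidAlgebra.single (wd s k p) (1 : ℕ) := by
  classical
  induction k with
  | zero => simp [wd, MonoidAlgebra.one_def]
  | succ k ih =>
    rw [pow_succ', ih, ← (Fin.consEquiv (fun _ => G × G)).sum_comp, Fintype.sum_prod_type]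
    have : cls s * cls s⁻¹ = ∑ q : G × G, MonoidAlgebra.single
        ((q.1 * s * q.1⁻¹) * (q.2 * s⁻¹ * q.2⁻¹)) (1 : ℕ) := by
      rw [cls, cls, Finset.sum_mul_sum, Fintype.sum_prod_type]
      simp only [MonoidAlgebra.single_mul_single, mul_one]
    rw [this, Finset.sum_mul_sum]
    refine Finset.sum_congr rfl fun q _ => Finset.sum_congr rfl fun p _ => ?_
    rw [MonoidAlgebra.single_mul_single]
    simp [wd, List.finRange_succ, Fin.consEquiv, Function.comp_def]

lemma wd_count {G : Type} [Group G] [Fintype G] (s : G) (k : ℕ) :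
    (Fintype.card G) ^ (2 * k) ≤
      Fintype.card G * Nat.card {p : Fin k → G × G // wd s k p = 1} := by
  classical
  have h1 : Nat.card {p : Fin k → G × G // wd s k p = 1} =
      ((cls s * cls s⁻¹) ^ k).coeff 1 := by
    rw [cls_expand]
    simp only [MonoidAlgebra.coeff_sum, Finsupp.finsetSum_apply,
      MonoidAlgebra.coeff_single_apply]
    rw [Nat.card_eq_fintype_card, Fintype.card_subtype]
    simp
  have h2 : ((cls s * cls s⁻¹) ^ k).coeff 1 = ∑ w : G, ((cls s) ^ k).coeff w ^ 2 := by
    rw [(cls_comm s s⁻¹).mul_pow, MonoidAlgebra.coeff_mul_apply_left, Finsupp.sum_fintype]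
    · refine Finset.sum_congr rfl fun w _ => ?_
      rw [mul_one, ← cls_coeff, sq]
    · simp
  rw [h1, h2, mul_comm 2 k, pow_mul, ← cls_mass s k]
  simpa using sq_sum_le_card_mul_sum_sq (s := (Finset.univ : Finset G))
    (f := fun w => ((cls s) ^ k).coeff w)

/-- subgroup attached to a permutation representation -/
def stabSub {Γ X : Type} [Group Γ] (φ : Γ →* Equiv.Perm X) (x : X) : Subgroup Γ :=
  (MulAction.stabilizer (Equiv.Perm X) x).comap φ

lemma mem_stabSub {Γ X : Type} [Group Γ] (φ : Γ →* Equiv.Perm X) (x : X) (γ : Γ) :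
    γ ∈ stabSub φ x ↔ φ γ x = x := Iff.rfl

lemma stabSub_index {Γ X : Type} [Group Γ] [Fintype X] (φ : Γ →* Equiv.Perm X) (x : X) :
    0 < (stabSub φ x).index ∧ (stabSub φ x).index ≤ Fintype.card X := by
  let _ : MulAction Γ X := MulAction.compHom X φ
  have h : stabSub φ x = MulAction.stabilizer Γ x := by
    ext γ; exact Iff.rfl
  rw [h, MulAction.index_stabilizer]
  refine ⟨(Set.ncard_pos (Set.toFinite _)).2 ⟨x, MulAction.mem_orbit_self x⟩, ?_⟩
  rw [← Nat.card_eq_fintype_card]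
  exact Set.ncard_le_card _

lemma hom_eq_of_stabSub {Γ X : Type} [Group Γ] (φ ψ : Γ →* Equiv.Perm X) (x : X) (α : Γ)
    (hα : φ α = ψ α) (htr : ∀ y, ∃ k : ℤ, ((φ α) ^ k) x = y)
    (h : stabSub φ x = stabSub ψ x) : φ = ψ := by
  ext γ y
  obtain ⟨k, rfl⟩ := htr y
  obtain ⟨j, hj⟩ := htr (φ γ (((φ α) ^ k) x))
  have h1 : (α ^ (-j) * γ * α ^ k) ∈ stabSub φ x := by
    rw [mem_stabSub]
    simp only [map_mul, map_inv, map_zpow, Equiv.Perm.mul_apply, zpow_neg, ← hj]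
    simp
  rw [h, mem_stabSub] at h1
  simp only [map_mul, map_inv, map_zpow, Equiv.Perm.mul_apply, zpow_neg, ← hα] at h1
  rw [Equiv.Perm.inv_eq_iff_eq] at h1
  rw [← hj, h1]

lemma finite_homs (g : ℕ) (K : Type) [Group K] [Finite K] : Finite (SurfaceGroup g →* K) := by
  refine Finite.of_injective
    (fun φ : SurfaceGroup g →* K => fun i : Fin (2 * g) => φ (PresentedGroup.of i)) ?_
  intro φ ψ h
  exact PresentedGroup.ext fun i => congrFun h i

lemma finite_subgroups (g k : ℕ) (hk : 0 < k) :
    {H : Subgroup (SurfaceGroup g) | H.index = k}.Finite := by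
  have := finite_homs g (Equiv.Perm (Fin k))
  refine (Set.finite_range (fun p : (SurfaceGroup g →* Equiv.Perm (Fin k)) × Fin k =>
    stabSub p.1 p.2)).subset ?_
  rintro H hH
  have hH : Nat.card (SurfaceGroup g ⧸ H) = k := hH
  have : Finite (SurfaceGroup g ⧸ H) := Nat.finite_of_card_ne_zero (by omega)
  let e : (SurfaceGroup g ⧸ H) ≃ Fin k := Finite.equivFinOfCardEq hH
  refine ⟨(e.permCongrHom.toMonoidHom.comp
    (MulAction.toPermHom (SurfaceGroup g) (SurfaceGroup g ⧸ H)), e (1 : SurfaceGroup g)), ?_⟩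
  ext γ
  rw [mem_stabSub]
  have : (e (γ • ((1 : SurfaceGroup g) : SurfaceGroup g ⧸ H)) = e (1 : SurfaceGroup g)) ↔ γ ∈ H := by
    rw [e.injective.eq_iff, MulAction.Quotient.smul_coe, eq_comm, QuotientGroup.eq]
    simp
  rw [← this]
  simp [Equiv.permCongrHom]

lemma finite_covers (g0 g : ℕ) (hg0 : 2 ≤ g0) :
    Finite {H : Subgroup (SurfaceGroup g0) // 0 < H.index ∧ H.index * (g0 - 1) + 1 ≤ g} := by
  have : ({H : Subgroup (SurfaceGroup g0) | 0 < H.index ∧ H.index * (g0 - 1) + 1 ≤ g}).Finite := by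
    refine (Set.Finite.biUnion (Set.finite_Ioc 0 g)
      (t := fun k => {H : Subgroup (SurfaceGroup g0) | H.index = k})
      (fun k hk => finite_subgroups g0 k hk.1)).subset ?_
    rintro H ⟨h1, h2⟩
    simp only [Set.mem_iUnion]
    refine ⟨H.index, ⟨h1, ?_⟩, rfl⟩
    have : H.index * 1 ≤ H.index * (g0 - 1) := Nat.mul_le_mul_left _ (by omega)
    omega
  exact this

/-- generator assignment -/
def gens {G : Type} (g : ℕ) (a b : Fin g → G) (j : Fin (2 * g)) : G :=
  if j.1 % 2 = 0 then a ⟨j.1 / 2, by omega⟩ else b ⟨j.1 / 2, by omega⟩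

lemma gens_even {G : Type} (g : ℕ) (a b : Fin g → G) (i : Fin g) (h : 2 * i.1 < 2 * g) :
    gens g a b ⟨2 * i.1, h⟩ = a i := by
  simp [gens]

lemma gens_odd {G : Type} (g : ℕ) (a b : Fin g → G) (i : Fin g) (h : 2 * i.1 + 1 < 2 * g) :
    gens g a b ⟨2 * i.1 + 1, h⟩ = b i := by
  have h1 : (2 * i.1 + 1) % 2 = 1 := by omega
  have h2 : (2 * i.1 + 1) / 2 = i.1 := by omega
  simp [gens, h1, h2]

lemma lift_rel {G : Type} [Group G] (g : ℕ) (s : G) (p : Fin g → G × G) (hp : wd s g p = 1) :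
    ∀ r ∈ ({surfaceRelator g} : Set (FreeGroup (Fin (2 * g)))),
      FreeGroup.lift (gens g (fun i => (p i).1 * s * (p i).1⁻¹)
        (fun i => (p i).2 * (p i).1⁻¹)) r = 1 := by
  rintro r rfl
  rw [surfaceRelator, map_list_prod, List.map_map, ← hp, wd]
  congr 1
  refine List.map_congr_left fun i _ => ?_
  simp only [Function.comp_apply, map_mul, map_inv, FreeGroup.lift_apply_of, gens_even, gens_odd]
  group

/-- The representation attached to a solution. -/
def rep {G : Type} [Group G] (g : ℕ) (s : G) (p : {p : Fin g → G × G // wd s g p = 1}) :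
    SurfaceGroup g →* G := PresentedGroup.toGroup (lift_rel g s p.1 p.2)

lemma perm_eq_of_conj {X : Type} (s u u' : Equiv.Perm X) (x : X)
    (hs : ∀ y, ∃ k : ℤ, (s ^ k) x = y) (h : u * s * u⁻¹ = u' * s * u'⁻¹) (hx : u x = u' x) :
    u = u' := by
  ext y
  obtain ⟨k, rfl⟩ := hs y
  have h1 : u * s ^ k * u⁻¹ = u' * s ^ k * u'⁻¹ := by
    rw [← conj_zpow, ← conj_zpow, h]
  have h2 := congrArg (fun q : Equiv.Perm X => q (u x)) h1
  have h3 : u'⁻¹ (u x) = x := by rw [hx]; simp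
  have h4 : u⁻¹ (u x) = x := by simp
  simpa only [Equiv.Perm.mul_apply, h3, h4] using h2

lemma main_count (g0 g n : ℕ) (hg0 : 2 ≤ g0) (hn : 0 < n) (hng : n * (g0 - 1) + 1 ≤ g) :
    n.factorial ^ (2 * g0) ≤ n.factorial * (Nat.card {H : Subgroup (SurfaceGroup g0) //
            0 < H.index ∧ H.index * (g0 - 1) + 1 ≤ g} * n.factorial * n ^ g0) := by
  classical
  have : NeZero n := ⟨hn.ne'⟩
  have := finite_covers g0 g hg0
  let s : Equiv.Perm (ZMod n) := Equiv.addRight 1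
  have hs : ∀ y, ∃ k : ℤ, (s ^ k) 0 = y := by
    intro y
    refine ⟨(y.val : ℤ), ?_⟩
    have : ∀ m : ℕ, (s ^ m) 0 = (m : ZMod n) := by
      intro m
      induction m with
      | zero => simp
      | succ m ih => rw [pow_succ', Equiv.Perm.mul_apply, ih]; simp [s]
    rw [zpow_natCast, this]; simp
  have hcard : Fintype.card (Equiv.Perm (ZMod n)) = n.factorial := by
    rw [Fintype.card_perm, ZMod.card]
  have h := wd_count s g0
  rw [hcard] at h
  refine h.trans (Nat.mul_le_mul_left _ ?_)
  let i0 : Fin g0 := ⟨0, by omega⟩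
  let F : {p : Fin g0 → Equiv.Perm (ZMod n) × Equiv.Perm (ZMod n) // wd s g0 p = 1} →
      ({H : Subgroup (SurfaceGroup g0) // 0 < H.index ∧ H.index * (g0 - 1) + 1 ≤ g} ×
        Equiv.Perm (ZMod n)) × (Fin g0 → ZMod n) := fun p =>
    ((⟨stabSub (rep g0 s p) 0, (stabSub_index _ _).1, by
      have := (stabSub_index (rep g0 s p) 0).2
      rw [ZMod.card] at this
      have := Nat.mul_le_mul_right (g0 - 1) this
      omega⟩, (p.1 i0).1), fun i => (p.1 i).1 0)
  have hF : Function.Injective F := by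
    intro p q hpq
    simp only [F, Prod.mk.injEq, Subtype.mk.injEq] at hpq
    obtain ⟨⟨h1, h2⟩, h3⟩ := hpq
    have hA : ∀ (p : {p : Fin g0 → Equiv.Perm (ZMod n) × Equiv.Perm (ZMod n) // wd s g0 p = 1})
        (i : Fin g0), rep g0 s p (PresentedGroup.of ⟨2 * i.1, by omega⟩) =
          (p.1 i).1 * s * (p.1 i).1⁻¹ := by
      intro p i
      rw [rep, PresentedGroup.toGroup.of, gens_even]
    have hB : ∀ (p : {p : Fin g0 → Equiv.Perm (ZMod n) × Equiv.Perm (ZMod n) // wd s g0 p = 1})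
        (i : Fin g0), rep g0 s p (PresentedGroup.of ⟨2 * i.1 + 1, by omega⟩) =
          (p.1 i).2 * (p.1 i).1⁻¹ := by
      intro p i
      rw [rep, PresentedGroup.toGroup.of, gens_odd]
    have hrep : rep g0 s p = rep g0 s q := by
      refine hom_eq_of_stabSub _ _ 0 (PresentedGroup.of ⟨2 * i0.1, by omega⟩) ?_ ?_ h1
      · rw [hA, hA, h2]
      · intro y
        rw [hA]
        obtain ⟨j, hj⟩ := hs ((p.1 i0).1⁻¹ 0)
        obtain ⟨k, hk⟩ := hs ((p.1 i0).1⁻¹ y)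
        refine ⟨k - j, ?_⟩
        rw [conj_zpow]
        simp only [Equiv.Perm.mul_apply]
        rw [← hj, ← Equiv.Perm.mul_apply (s ^ (k - j)), ← zpow_add, sub_add_cancel, hk]
        simp
    apply Subtype.ext
    funext i
    have e1 : (p.1 i).1 = (q.1 i).1 := by
      refine perm_eq_of_conj s _ _ 0 hs ?_ (congrFun h3 i)
      rw [← hA, ← hA, hrep]
    have e2 : (p.1 i).2 = (q.1 i).2 := by
      have := hB p i
      rw [hrep, hB q i, e1] at this
      exact (mul_right_cancel this).symm
    exact Prod.ext e1 e2
  have := Nat.card_le_card_of_injective F hF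
  rw [Nat.card_prod, Nat.card_prod, Nat.card_eq_fintype_card (α := Equiv.Perm (ZMod n)), hcard,
    Nat.card_fun, Nat.card_eq_fintype_card (α := ZMod n), ZMod.card, Nat.card_fin] at this
  exact this

/-- For the closed connected orientable surface `S` of
genus `g0 ≥ 2`, the number of connected finite covers of genus at most `g` —
i.e. of finite-index subgroups `H ≤ π₁(S) = SurfaceGroup g0` whose associated
cover has genus `(index H)·(g0−1)+1 ≤ g` — is at least `(c1·g)^{2g}` for all
sufficiently large `g`, for some constant `c1 > 0` depending only on `S`. -/
theorem covers_lower_bound (g0 : ℕ) (hg0 : 2 ≤ g0) :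
    ∃ c1 : ℝ, 0 < c1 ∧
      ∀ᶠ g : ℕ in Filter.atTop,
        ((c1 * g) ^ (2 * g) : ℝ) ≤
          Nat.card {H : Subgroup (SurfaceGroup g0) //
            0 < H.index ∧ H.index * (g0 - 1) + 1 ≤ g} := by
  obtain ⟨m, rfl⟩ : ∃ m, g0 = m + 1 := ⟨g0 - 1, by omega⟩
  have hm : 1 ≤ m := by omega
  have hmR : (1 : ℝ) ≤ m := by exact_mod_cast hm
  refine ⟨1 / (24 * m), by positivity, ?_⟩
  filter_upwards [eventually_ge_atTop (12 * m + 1)] with g hg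
  have hsub : m + 1 - 1 = m := by omega
  set n := (g - 1) / m with hn_def
  have hn12 : 12 ≤ n := by
    rw [hn_def, Nat.le_div_iff_mul_le (by omega)]; omega
  have hng : n * m + 1 ≤ g := by
    have := Nat.div_mul_le_self (g - 1) m
    rw [← hn_def] at this
    omega
  have hgn : g ≤ n * m + m := by
    have h1 := Nat.div_add_mod (g - 1) m
    have h2 := Nat.mod_lt (g - 1) (show m > 0 by omega)
    rw [← hn_def, mul_comm] at h1
    omega
  have key := main_count (m + 1) g n hg0 (by omega) (by rw [hsub]; exact hng)
  set N := Nat.card {H : Subgroup (SurfaceGroup (m + 1)) //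
            0 < H.index ∧ H.index * (m + 1 - 1) + 1 ≤ g} with hN
  have hf : 0 < n.factorial := Nat.factorial_pos n
  have key2 : n.factorial ^ (2 * m) ≤ N * n ^ (m + 1) := by
    have : n.factorial ^ 2 * n.factorial ^ (2 * m) ≤ n.factorial ^ 2 * (N * n ^ (m + 1)) := by
      calc _ = n.factorial ^ (2 * (m + 1)) := by ring
        _ ≤ _ := key
        _ = _ := by ring
    exact Nat.le_of_mul_le_mul_left this (by positivity)
  have key3 : ((n.factorial : ℝ)) ^ (2 * m) ≤ N * (n : ℝ) ^ (m + 1) := by exact_mod_cast key2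
  have hnR : (12 : ℝ) ≤ n := by exact_mod_cast hn12
  have hfac : ((n : ℝ) / 3) ^ n ≤ n.factorial := by
    have h1 := Real.pow_div_factorial_le_exp (n : ℝ) (by positivity) n
    have h2 : Real.exp n ≤ 3 ^ n := by
      rw [← Real.exp_one_pow]
      exact pow_le_pow_left₀ (Real.exp_pos 1).le (by linarith [Real.exp_one_lt_d9]) n
    have h3 := h1.trans h2
    rw [div_le_iff₀ (by positivity)] at h3
    rw [div_pow, div_le_iff₀ (by positivity)]
    linarith
  have hexp : (n : ℝ) ^ 2 ≤ 4 ^ n := by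
    have h1 : (n : ℝ) ≤ 2 ^ n := by exact_mod_cast (Nat.lt_two_pow_self (n := n)).le
    calc (n : ℝ) ^ 2 ≤ (2 ^ n) ^ 2 := pow_le_pow_left₀ (by positivity) h1 2
      _ = 4 ^ n := by rw [← pow_mul, mul_comm, pow_mul]; norm_num
  have hcg : 1 / (24 * (m : ℝ)) * g ≤ n / 12 := by
    have h1 : (g : ℝ) ≤ n * m + m := by exact_mod_cast hgn
    have h2 : (g : ℝ) ≤ 2 * n * m := by nlinarith
    rw [one_div, inv_mul_le_iff₀ (by positivity)]
    linarith
  have hn1 : (1 : ℝ) ≤ n / 12 := by linarith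
  have step : (1 / (24 * (m : ℝ)) * g) ^ (2 * g) ≤ ((n : ℝ) / 12) ^ (2 * m * n + 2 * m) :=
    calc _ ≤ ((n : ℝ) / 12) ^ (2 * g) := pow_le_pow_left₀ (by positivity) hcg _
      _ ≤ _ := pow_le_pow_right₀ hn1 (by nlinarith)
  refine step.trans ?_
  have hpos : (0 : ℝ) < (n : ℝ) ^ (m + 1) := by positivity
  refine le_of_mul_le_mul_right ?_ hpos
  refine le_trans ?_ key3
  calc ((n : ℝ) / 12) ^ (2 * m * n + 2 * m) * (n : ℝ) ^ (m + 1)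
      ≤ ((n : ℝ) / 12) ^ (2 * m * n) * (n : ℝ) ^ (2 * m) * (n : ℝ) ^ (2 * m) := by
        rw [pow_add]
        have a1 : ((n : ℝ) / 12) ^ (2 * m) ≤ (n : ℝ) ^ (2 * m) :=
          pow_le_pow_left₀ (by positivity) (by linarith) _
        have a2 : (n : ℝ) ^ (m + 1) ≤ (n : ℝ) ^ (2 * m) :=
          pow_le_pow_right₀ (by linarith) (by omega)
        gcongr
    _ = (((n : ℝ) / 12) ^ n * (n : ℝ) ^ 2) ^ (2 * m) := by ring
    _ ≤ (((n : ℝ) / 12) ^ n * 4 ^ n) ^ (2 * m) := by gcongr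
    _ = (((n : ℝ) / 3) ^ n) ^ (2 * m) := by rw [← mul_pow]; congr 2; ring
    _ ≤ _ := by gcongr
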